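/- arXiv:2402.13477 — 2 statements merged into one kernel-verified Lean document; each statement's English description precedes it below -/
import Mathlib

section
/- Let K be a field, 2 ≤ t ≤ n, S = K[x_1,…,x_n] with its standard grading, and write n = a t + b with a ≥ 1 and 0 ≤ b < t. Then the multiplicity of S/I_t(L_n) equals binomial(a + t − b − 1, a); that is, the Hilbert function k ↦ dim_K (S/I_t(L_n))_k agrees for all sufficiently large k with a polynomial in k of degree n − a − 1 whose leading coefficient is binomial(a + t − b − 1, a)/(n − a − 1)!. -/
open MvPolynomial

/-- Generator of the path ideal: the product `x_{i+1} ⋯ x_{i+t}` of the variables with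
0-based indices in `[i, i+t)`. -/
noncomputable def pathGen (K : Type*) [Field K] (n t i : ℕ) : MvPolynomial (Fin n) K :=
  ∏ j ∈ Finset.univ.filter (fun j : Fin n => i ≤ (j : ℕ) ∧ (j : ℕ) < i + t), X j

/-- The `t`-path ideal `I_t(L_n)` of the line graph `L_n`. -/
noncomputable def pathIdeal (K : Type*) [Field K] (n t : ℕ) : Ideal (MvPolynomial (Fin n) K) :=
  Ideal.span ((pathGen K n t) '' {i : ℕ | i + t ≤ n})

/-- The Hilbert function of the graded quotient `S/I`: the `K`-dimension of the image of the
space of homogeneous polynomials of degree `k` in `S/I`. -/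
noncomputable def hilbertFn (K : Type*) [Field K] (n : ℕ)
    (I : Ideal (MvPolynomial (Fin n) K)) (k : ℕ) : ℕ :=
  Module.finrank K
    ((homogeneousSubmodule (Fin n) K k).map (Ideal.Quotient.mkₐ K I).toLinearMap)

/-- The finset `C` lies in `[0, n)` and meets every interval `[i, i + t) ⊆ [0, n)`. -/
def IsPathCover (t n : ℕ) (C : Finset ℕ) : Prop :=
  C ⊆ Finset.range n ∧ ∀ i, i + t ≤ n → ∃ x ∈ C, i ≤ x ∧ x < i + t

theorem IsPathCover.filter_lt {t n m : ℕ} {C : Finset ℕ} (h : IsPathCover t n C) (hm : m ≤ n) :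
    IsPathCover t m (C.filter (· < m)) := by
  refine ⟨fun x hx ↦ by simp_all, fun i hi ↦ ?_⟩
  obtain ⟨x, hx, h1, h2⟩ := h.2 i (hi.trans hm)
  exact ⟨x, by simp [hx]; omega, h1, h2⟩

theorem IsPathCover.le_card {t : ℕ} : ∀ {a n : ℕ} {C : Finset ℕ}, IsPathCover t n C →
    a * t ≤ n → a ≤ C.card
  | 0, _, _, _, _ => Nat.zero_le _
  | a + 1, n, C, h, han => by
    rw [add_mul, one_mul] at han
    have h1 := (h.filter_lt (m := a * t) (by omega)).le_card le_rfl
    obtain ⟨x, hx, h2, -⟩ := h.2 _ han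
    refine Nat.succ_le_of_lt (h1.trans_lt (Finset.card_lt_card ?_))
    refine (Finset.ssubset_iff_of_subset (Finset.filter_subset _ _)).2 ⟨x, hx, by simp [h2]⟩

open Classical in
/-- The covers of `[0, n)` with `a` elements. -/
noncomputable def pathCovers (t n a : ℕ) : Finset (Finset ℕ) :=
  ((Finset.range n).powersetCard a).filter (IsPathCover t n)

theorem mem_pathCovers {t n a : ℕ} {C : Finset ℕ} :
    C ∈ pathCovers t n a ↔ IsPathCover t n C ∧ C.card = a := by
  simp only [pathCovers, Finset.mem_filter, Finset.mem_powersetCard, IsPathCover]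
  tauto

theorem filter_notMem_pathCovers {t a b : ℕ} (ht : 0 < t) :
    (pathCovers t ((a + 1) * t + b) (a + 1)).filter (a * t + b ∉ ·) =
      pathCovers t ((a + 1) * t + b + 1) (a + 1) := by
  ext C
  simp only [Finset.mem_filter, mem_pathCovers]
  have hn : (a + 1) * t + b = a * t + b + t := by ring
  rw [hn]
  constructor
  · rintro ⟨⟨⟨hs, h⟩, hc⟩, hp⟩
    refine ⟨⟨fun x hx ↦ ?_, fun i hi ↦ ?_⟩, hc⟩
    · have := Finset.mem_range.1 (hs hx)
      simp; omega
    · rcases Nat.lt_or_ge (a * t + b) i with hi' | hi'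
      · obtain ⟨x, hx, h1, h2⟩ := h (a * t + b) le_rfl
        have : x ≠ a * t + b := fun e ↦ hp (e ▸ hx)
        exact ⟨x, hx, by omega, by omega⟩
      · exact h i (by omega)
  · rintro ⟨h, hc⟩
    have h0 := h.filter_lt (m := a * t + b + t) (by omega)
    have hC : C.filter (· < a * t + b + t) = C :=
      Finset.eq_of_subset_of_card_le (Finset.filter_subset _ _)
        (hc.trans_le (h0.le_card (by rw [← hn]; omega)))
    rw [hC] at h0
    refine ⟨⟨h0, hc⟩, fun hp ↦ ?_⟩
    have h1 := (h.filter_lt (m := a * t + b) (by omega)).le_card (a := a) (by omega)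
    obtain ⟨x, hx, hx1, hx2⟩ := h.2 (a * t + b + 1) (by omega)
    have h2 : insert x (insert (a * t + b) (C.filter (· < a * t + b))) ⊆ C := by
      intro y
      simp only [Finset.mem_insert, Finset.mem_filter]
      rintro (rfl | rfl | ⟨h, -⟩) <;> assumption
    have h3 := Finset.card_le_card h2
    rw [Finset.card_insert_of_notMem (by simp; omega), Finset.card_insert_of_notMem (by simp)] at h3
    omega

theorem card_filter_mem_pathCovers {t a b : ℕ} (ht : 0 < t) :
    ((pathCovers t ((a + 1) * t + b) (a + 1)).filter (a * t + b ∈ ·)).card =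
      (pathCovers t (a * t + b) a).card := by
  have hn : (a + 1) * t + b = a * t + b + t := by ring
  refine Finset.card_nbij' (fun C ↦ C.erase (a * t + b)) (insert (a * t + b)) ?_ ?_ ?_ ?_
  · intro C hC
    simp only [Finset.coe_filter, Set.mem_ofPred_eq, mem_pathCovers, Finset.mem_coe] at hC ⊢
    obtain ⟨⟨h, hc⟩, hp⟩ := hC
    have h0 := h.filter_lt (m := a * t + b) (by omega)
    have h1 := h0.le_card (a := a) (by omega)
    have h2 : C.filter (· < a * t + b) = C.erase (a * t + b) := by
      refine Finset.eq_of_subset_of_card_le (fun x hx ↦ ?_) ?_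
      · simp only [Finset.mem_filter, Finset.mem_erase] at hx ⊢
        exact ⟨hx.2.ne, hx.1⟩
      · rw [Finset.card_erase_of_mem hp]; omega
    rw [← h2]
    refine ⟨h0, ?_⟩
    rw [h2, Finset.card_erase_of_mem hp, hc]; rfl
  · intro C hC
    simp only [Finset.coe_filter, Set.mem_ofPred_eq, mem_pathCovers, Finset.mem_coe] at hC ⊢
    obtain ⟨⟨hs, h⟩, hc⟩ := hC
    have hp : a * t + b ∉ C := fun hp ↦ by simpa using hs hp
    refine ⟨⟨⟨fun x hx ↦ ?_, fun i hi ↦ ?_⟩, ?_⟩, Finset.mem_insert_self _ _⟩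
    · rcases Finset.mem_insert.1 hx with rfl | hx
      · simp; omega
      · have := Finset.mem_range.1 (hs hx)
        simp; omega
    · rcases Nat.lt_or_ge (a * t + b) (i + t) with hi' | hi'
      · exact ⟨_, Finset.mem_insert_self _ _, by omega, hi'⟩
      · obtain ⟨x, hx, hx'⟩ := h i hi'
        exact ⟨x, Finset.mem_insert_of_mem hx, hx'⟩
    · rw [Finset.card_insert_of_notMem hp, hc]
  · intro C hC
    simp only [Finset.coe_filter, Set.mem_ofPred_eq] at hC
    exact Finset.insert_erase hC.2
  · intro C hC
    simp only [Finset.mem_coe, mem_pathCovers] at hC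
    exact Finset.erase_insert fun hp ↦ by simpa using hC.1.1 hp

theorem card_pathCovers {t : ℕ} : ∀ (a s b : ℕ), b + s + 1 = t →
    (pathCovers t (a * t + b) a).card = (a + s).choose a
  | 0, s, b, h => by
    have : pathCovers t (0 * t + b) 0 = {∅} := by
      ext C
      simp only [mem_pathCovers, Finset.card_eq_zero, Finset.mem_singleton, and_iff_right_iff_imp]
      rintro rfl
      exact ⟨by simp, fun i hi ↦ by omega⟩
    rw [this]; simp
  | a + 1, s, b, h => by
    rw [← Finset.card_filter_add_card_filter_not (a * t + b ∈ ·),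
      card_filter_mem_pathCovers (by omega), filter_notMem_pathCovers (by omega),
      card_pathCovers a s b h]
    cases s with
    | zero =>
      have : pathCovers t ((a + 1) * t + b + 1) (a + 1) = ∅ := by
        refine Finset.eq_empty_of_forall_notMem fun C hC ↦ ?_
        obtain ⟨h1, h2⟩ := mem_pathCovers.1 hC
        have := h1.le_card (a := a + 2) (by rw [add_assoc, ← h]; apply le_of_eq; ring)
        omega
      simp [this]
    | succ s =>
      rw [add_assoc, card_pathCovers (a + 1) s (b + 1) (by omega), ← add_assoc, ← add_assoc,
        Nat.choose_succ_succ, add_right_comm]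
termination_by a s => (a, s)

/-- A set of vertices of `L_n` is path free if it contains no `t` consecutive vertices. -/
def IsPathFree (n t : ℕ) (F : Finset (Fin n)) : Prop :=
  ∀ i, i + t ≤ n → ∃ j ∉ F, i ≤ (j : ℕ) ∧ (j : ℕ) < i + t

theorem IsPathFree.isPathCover {n t : ℕ} {F : Finset (Fin n)} (h : IsPathFree n t F) :
    IsPathCover t n (Fᶜ.map Fin.valEmbedding) := by
  refine ⟨fun x hx ↦ ?_, fun i hi ↦ ?_⟩
  · obtain ⟨j, -, rfl⟩ := Finset.mem_map.1 hx
    simp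
  · obtain ⟨j, hj, hj'⟩ := h i hi
    exact ⟨j, Finset.mem_map_of_mem Fin.valEmbedding (by simpa using hj), hj'⟩

theorem IsPathFree.card_le {n t a : ℕ} {F : Finset (Fin n)} (h : IsPathFree n t F)
    (ha : a * t ≤ n) : F.card ≤ n - a := by
  have h1 := h.isPathCover.le_card ha
  rw [Finset.card_map, Finset.card_compl, Fintype.card_fin] at h1
  have := card_finset_fin_le F
  omega

open Classical in
theorem card_isPathFree {n t a : ℕ} (han : a ≤ n) :
    {F : Finset (Fin n) | IsPathFree n t F ∧ F.card = n - a}.toFinset.card =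
      (pathCovers t n a).card := by
  refine Finset.card_bij (fun F _ ↦ Fᶜ.map Fin.valEmbedding) ?_ ?_ ?_
  · intro F hF
    simp only [Set.mem_toFinset, Set.mem_ofPred_eq] at hF
    refine mem_pathCovers.2 ⟨hF.1.isPathCover, ?_⟩
    rw [Finset.card_map, Finset.card_compl, Fintype.card_fin, hF.2]
    omega
  · intro F _ G _ h
    exact compl_injective (Finset.map_injective _ h)
  · intro C hC
    obtain ⟨⟨hs, h⟩, hc⟩ := mem_pathCovers.1 hC
    have hmap : ((Finset.univ.filter fun j : Fin n ↦ (j : ℕ) ∉ C)ᶜ).map Fin.valEmbedding = C := by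
      ext x
      simp only [Finset.compl_filter, not_not, Finset.mem_map, Finset.mem_filter, Finset.mem_univ,
        true_and, Fin.valEmbedding_apply]
      exact ⟨fun ⟨j, hj, e⟩ ↦ e ▸ hj, fun hx ↦ ⟨⟨x, Finset.mem_range.1 (hs hx)⟩, hx, rfl⟩⟩
    refine ⟨_, ?_, hmap⟩
    simp only [Set.mem_toFinset, Set.mem_ofPred_eq]
    refine ⟨fun i hi ↦ ?_, ?_⟩
    · obtain ⟨x, hx, hx'⟩ := h i hi
      exact ⟨⟨x, Finset.mem_range.1 (hs hx)⟩, by simpa using hx, hx'⟩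
    · have h1 := congrArg Finset.card hmap
      rw [Finset.card_map, Finset.card_compl, Fintype.card_fin, hc] at h1
      have := card_finset_fin_le (Finset.univ.filter fun j : Fin n ↦ (j : ℕ) ∉ C)
      omega

open Classical in
theorem hilbertFn_span_monomial (K : Type*) [Field K] {n : ℕ} (s : Set (Fin n →₀ ℕ)) (k : ℕ) :
    hilbertFn K n (Ideal.span ((fun e ↦ monomial e (1 : K)) '' s)) k =
      ((Finset.univ.finsuppAntidiag k).filter fun m : Fin n →₀ ℕ ↦ ∀ e ∈ s, ¬ e ≤ m).card := by
  set I := Ideal.span ((fun e ↦ monomial e (1 : K)) '' s) with hI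
  set T := (Finset.univ.finsuppAntidiag k).filter fun m : Fin n →₀ ℕ ↦ ∀ e ∈ s, ¬ e ≤ m with hT
  set f := (Ideal.Quotient.mkₐ K I).toLinearMap with hf
  have hT' : ∀ m, m ∈ T ↔ m.degree = k ∧ ∀ e ∈ s, ¬ e ≤ m := fun m ↦ by
    simp [hT, Finsupp.degree_eq_sum]
  let v : T → MvPolynomial (Fin n) K := fun m ↦ monomial m.1 1
  have hv : LinearIndependent K v := by
    have := (basisMonomials (Fin n) K).linearIndependent.comp (Subtype.val : T → _)
      Subtype.val_injective
    rwa [coe_basisMonomials] at this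
  have hfv : LinearIndependent K (f ∘ v) := by
    refine hv.map (Submodule.disjoint_def.2 fun x hx hx' ↦ ?_)
    have h1 : x ∈ I := by simpa [hf, Ideal.Quotient.eq_zero_iff_mem] using hx'
    rw [hI, mem_ideal_span_monomial_image] at h1
    have h2 : ∀ m ∈ x.support, m ∈ T := fun m hm ↦ by
      by_contra hmT
      have hle : Submodule.span K (Set.range v) ≤ LinearMap.ker (lcoeff K m) := by
        rw [Submodule.span_le]
        rintro _ ⟨e, rfl⟩
        have : e.1 ≠ m := fun h ↦ hmT (h ▸ e.2)
        simp [v, coeff_monomial, this]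
      exact mem_support_iff.1 hm (hle hx)
    rw [← support_eq_empty]
    refine Finset.eq_empty_of_forall_notMem fun m hm ↦ ?_
    obtain ⟨e, he, hem⟩ := h1 m hm
    exact ((hT' m).1 (h2 m hm)).2 e he hem
  have hspan : (homogeneousSubmodule (Fin n) K k).map f =
      Submodule.span K (Set.range (f ∘ v)) := by
    apply le_antisymm
    · rintro _ ⟨p, hp, rfl⟩
      rw [p.as_sum, map_sum]
      refine Submodule.sum_mem _ fun m hm ↦ ?_
      have hdeg : m.degree = k := by
        have hp' : p.IsHomogeneous k := (mem_homogeneousSubmodule k p).1 hp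
        rw [Finsupp.degree_eq_weight_one]
        exact hp' (mem_support_iff.1 hm)
      by_cases hmT : m ∈ T
      · have : f (monomial m (p.coeff m)) = p.coeff m • (f ∘ v) ⟨m, hmT⟩ := by
          rw [Function.comp_apply, ← map_smul, smul_monomial, smul_eq_mul, mul_one]
        rw [this]
        exact Submodule.smul_mem _ _ (Submodule.subset_span ⟨_, rfl⟩)
      · have : monomial m (p.coeff m) ∈ I := by
          rw [hI, mem_ideal_span_monomial_image]
          intro e he
          obtain rfl : e = m := by simpa using support_monomial_subset he
          simpa [hT', hdeg] using hmT
        have h0 : f (monomial m (p.coeff m)) = 0 := by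
          simpa [hf, Ideal.Quotient.eq_zero_iff_mem] using this
        rw [h0]
        exact Submodule.zero_mem _
    · rw [Submodule.span_le]
      rintro _ ⟨m, rfl⟩
      exact ⟨v m, (mem_homogeneousSubmodule _ _).2 (isHomogeneous_monomial _ ((hT' m.1).1 m.2).1),
        rfl⟩
  rw [hilbertFn, hspan, finrank_span_eq_card hfv, Fintype.card_coe]

theorem pathGen_eq_monomial (K : Type*) [Field K] (n t i : ℕ) :
    pathGen K n t i = monomial (∑ j ∈ Finset.univ.filter
      (fun j : Fin n => i ≤ (j : ℕ) ∧ (j : ℕ) < i + t), Finsupp.single j 1) 1 := by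
  rw [monomial_sum_one]; rfl

theorem sum_single_one_le_iff {σ : Type*} {A : Finset σ} {m : σ →₀ ℕ} :
    ∑ j ∈ A, Finsupp.single j 1 ≤ m ↔ A ⊆ m.support := by
  classical
  rw [Finsupp.le_def]
  simp only [Finsupp.finsetSum_apply, Finsupp.single_apply, Finset.sum_ite_eq']
  refine ⟨fun h j hj ↦ ?_, fun h j ↦ ?_⟩
  · have := h j
    rw [if_pos hj] at this
    simp; omega
  · split_ifs with hj
    · exact Nat.one_le_iff_ne_zero.2 (Finsupp.mem_support_iff.1 (h hj))
    · exact Nat.zero_le _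

open Classical in
theorem hilbertFn_pathIdeal (K : Type*) [Field K] (n t k : ℕ) :
    hilbertFn K n (pathIdeal K n t) k =
      ((Finset.univ.finsuppAntidiag k).filter fun m : Fin n →₀ ℕ ↦
        IsPathFree n t m.support).card := by
  have : pathIdeal K n t = Ideal.span ((fun e ↦ monomial e (1 : K)) ''
      ((fun i ↦ ∑ j ∈ Finset.univ.filter
        (fun j : Fin n => i ≤ (j : ℕ) ∧ (j : ℕ) < i + t), Finsupp.single j 1) ''
          {i : ℕ | i + t ≤ n})) := by
    rw [pathIdeal, Set.image_image]
    simp only [← pathGen_eq_monomial]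
  rw [this, hilbertFn_span_monomial]
  congr 1
  refine Finset.filter_congr fun m _ ↦ ?_
  simp only [Set.forall_mem_image, sum_single_one_le_iff, Finset.not_subset, Set.mem_ofPred_eq,
    Finset.mem_filter, Finset.mem_univ, true_and, IsPathFree]
  exact forall₂_congr fun i _ ↦ exists_congr fun j ↦ and_comm

/-- The monomials of degree `k` with support exactly `F`, for `F` nonempty. -/
theorem card_finsuppAntidiag_support_eq {σ : Type*} [Fintype σ] [DecidableEq σ] {F : Finset σ}
    {k : ℕ} (hF : F.Nonempty) (hk : F.card ≤ k) :
    ((Finset.univ.finsuppAntidiag k).filter fun m : σ →₀ ℕ ↦ m.support = F).card =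
      (k - 1).choose (F.card - 1) := by
  have hpos := hF.card_pos
  have h : (F.finsuppAntidiag (k - F.card)).card = (k - 1).choose (F.card - 1) := by
    rw [Finset.card_finsuppAntidiag_nat_eq_choose,
      ← Nat.choose_symm (by omega)]
    congr 1 <;> omega
  rw [← h, eq_comm]
  set u : σ →₀ ℕ := ∑ j ∈ F, Finsupp.single j 1 with hu
  have hu' : ∀ j, u j = if j ∈ F then 1 else 0 := fun j ↦ by
    simp [hu, Finsupp.finsetSum_apply, Finsupp.single_apply]
  have hsum : ∑ j, u j = F.card := by simp [hu']
  have hsub : ∀ m : σ →₀ ℕ, m.support ⊆ F → F.sum m = ∑ j, m j := fun m hm ↦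
    Finset.sum_subset (Finset.subset_univ _) fun j _ hj ↦
      Finsupp.notMem_support_iff.1 fun h ↦ hj (hm h)
  refine Finset.card_nbij' (· + u) (· - u) ?_ ?_ ?_ ?_
  · intro m hm
    simp only [Finset.mem_coe, Finset.mem_finsuppAntidiag, Finset.mem_filter] at hm ⊢
    refine ⟨⟨?_, Finset.subset_univ _⟩, ?_⟩
    · rw [hsub m hm.2] at hm
      change ∑ j, (m j + u j) = k
      rw [Finset.sum_add_distrib, hsum, hm.1]
      omega
    · ext j
      have := @hm.2 j
      simp only [Finsupp.mem_support_iff, Finsupp.add_apply, hu'] at this ⊢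
      split_ifs with hj <;> simp_all
  · intro m hm
    simp only [Finset.mem_coe, Finset.mem_finsuppAntidiag, Finset.mem_filter] at hm ⊢
    have hle : u ≤ m := by
      rw [hu, sum_single_one_le_iff, hm.2]
    have hsupp : (m - u).support ⊆ F := fun j hj ↦ by
      rw [← hm.2]
      simp only [Finsupp.mem_support_iff, Finsupp.tsub_apply] at hj ⊢
      omega
    refine ⟨?_, hsupp⟩
    rw [hsub _ hsupp]
    have h1 : ∑ j, (m - u + u) j = k := by rw [tsub_add_cancel_of_le hle, hm.1.1]
    simp only [Finsupp.add_apply, Finset.sum_add_distrib, hsum] at h1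
    omega
  · intro m _
    simp
  · intro m hm
    simp only [Finset.mem_coe, Finset.mem_finsuppAntidiag, Finset.mem_filter] at hm
    exact tsub_add_cancel_of_le (by rw [hu, sum_single_one_le_iff, hm.2])

/-- The Hilbert polynomial of the span of the monomials with support of cardinality `s`. -/
noncomputable def supportHilbertPoly : ℕ → Polynomial ℚ
  | 0 => 0
  | d + 1 => Polynomial.preHilbertPoly ℚ d (d + 1)

theorem natDegree_supportHilbertPoly (s : ℕ) : (supportHilbertPoly s).natDegree = s - 1 := by
  cases s with
  | zero => simp [supportHilbertPoly]
  | succ d => exact Polynomial.natDegree_preHilbertPoly ℚ d (d + 1)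

theorem eval_supportHilbertPoly {σ : Type*} [Fintype σ] [DecidableEq σ] (F : Finset σ)
    {k : ℕ} (hk : F.card ≤ k) (hk' : 1 ≤ k) :
    (((Finset.univ.finsuppAntidiag k).filter fun m : σ →₀ ℕ ↦ m.support = F).card : ℚ) =
      (supportHilbertPoly F.card).eval (k : ℚ) := by
  rcases F.eq_empty_or_nonempty with rfl | hF
  · rw [Finset.card_empty, supportHilbertPoly, Polynomial.eval_zero, Nat.cast_eq_zero,
      Finset.card_eq_zero]
    refine Finset.filter_eq_empty_iff.2 fun m hm h ↦ ?_
    rw [Finsupp.support_eq_empty] at h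
    subst h
    simp at hm
    omega
  · rw [card_finsuppAntidiag_support_eq hF hk]
    obtain ⟨d, hd⟩ := Nat.exists_eq_succ_of_ne_zero hF.card_pos.ne'
    rw [hd] at hk ⊢
    rw [supportHilbertPoly, Polynomial.preHilbertPoly_eq_choose_sub_add ℚ d hk]
    congr 2
    omega

/-- If `n = a t + b` with `a ≥ 1`, `0 ≤ b < t`, then the multiplicity of `S/I_t(L_n)`
equals `(a + t - b - 1).choose a`: the Hilbert function of `S/I_t(L_n)` eventually agrees
with a polynomial of degree `n - a - 1` and leading coefficient
`(a + t - b - 1).choose a / (n - a - 1)!`. -/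
theorem multiplicity_pathIdeal (K : Type*) [Field K] (n t a b : ℕ)
    (ht : 2 ≤ t) (htn : t ≤ n) (ha : 1 ≤ a) (hb : b < t) (hn : n = a * t + b) :
    ∃ P : Polynomial ℚ, P.degree = (n - a - 1 : ℕ) ∧
      P.leadingCoeff = ((a + t - b - 1).choose a : ℚ) / (n - a - 1).factorial ∧
      ∃ N : ℕ, ∀ k ≥ N, (hilbertFn K n (pathIdeal K n t) k : ℚ) = P.eval (k : ℚ) := by
  classical
  have h2a : a * 2 ≤ a * t := Nat.mul_le_mul_left a ht
  have hcount : {F : Finset (Fin n) | IsPathFree n t F ∧ F.card = n - a}.toFinset.card =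
      (a + t - b - 1).choose a := by
    rw [card_isPathFree (by omega), hn, card_pathCovers a (t - b - 1) b (by omega)]
    congr 1
    omega
  set G : Finset (Finset (Fin n)) := Finset.univ.filter (IsPathFree n t) with hG
  set P : Polynomial ℚ := ∑ F ∈ G, supportHilbertPoly F.card with hP
  have hcard : ∀ F ∈ G, F.card ≤ n - a := fun F hF ↦
    (Finset.mem_filter.1 hF).2.card_le (by omega)
  have hcoeff : P.coeff (n - a - 1) =
      ((a + t - b - 1).choose a : ℚ) / (n - a - 1).factorial := by
    have h1 : ∀ F ∈ G, (supportHilbertPoly F.card).coeff (n - a - 1) =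
        if F.card = n - a then ((n - a - 1).factorial : ℚ)⁻¹ else 0 := fun F hF ↦ by
      have h2 := hcard F hF
      split_ifs with h
      · obtain ⟨d, hd⟩ : ∃ d, n - a = d + 1 := ⟨n - a - 1, by omega⟩
        rw [h, hd]
        exact Polynomial.coeff_preHilbertPoly_self ℚ d (d + 1)
      · rcases Nat.eq_zero_or_pos F.card with h0 | h0
        · simp [h0, supportHilbertPoly]
        · refine Polynomial.coeff_eq_zero_of_natDegree_lt ?_
          rw [natDegree_supportHilbertPoly]
          omega
    rw [hP, Polynomial.finsetSum_coeff, Finset.sum_congr rfl h1, ← Finset.sum_filter,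
      Finset.sum_const, nsmul_eq_mul, div_eq_mul_inv, ← hcount]
    congr 3
    ext F
    simp [hG]
  have hne : P.coeff (n - a - 1) ≠ 0 := by
    rw [hcoeff]
    have := Nat.choose_pos (show a ≤ a + t - b - 1 by omega)
    positivity
  have hdeg : P.degree = (n - a - 1 : ℕ) := by
    refine Polynomial.degree_eq_of_le_of_coeff_ne_zero ?_ hne
    refine (Polynomial.degree_sum_le _ _).trans (Finset.sup_le fun F hF ↦ ?_)
    refine Polynomial.degree_le_natDegree.trans ?_
    rw [natDegree_supportHilbertPoly]
    have := hcard F hF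
    exact_mod_cast Nat.sub_le_sub_right this 1
  refine ⟨P, hdeg, ?_, n, fun k hk ↦ ?_⟩
  · rw [Polynomial.leadingCoeff, Polynomial.natDegree_eq_of_degree_eq_some hdeg, hcoeff]
  · rw [hilbertFn_pathIdeal, Finset.card_eq_sum_card_fiberwise (f := Finsupp.support) (t := G)
      (fun m hm ↦ by simpa [hG] using (Finset.mem_filter.1 hm).2), hP, Polynomial.eval_finsetSum,
      Nat.cast_sum]
    refine Finset.sum_congr rfl fun F hF ↦ ?_
    rw [← eval_supportHilbertPoly F ((card_finset_fin_le F).trans hk) (by omega),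
      Finset.filter_filter]
    congr 2
    refine Finset.filter_congr fun m _ ↦ and_iff_right_of_imp fun h ↦ ?_
    rw [h]
    exact (Finset.mem_filter.1 hF).2
end

section
/- Let K be a field, 2 ≤ t < n, and S = K[x_1,…,x_n]. For every s ≥ 2, one has (I_t(L_{n−1})^s : u_{n−t+1}) + (x_{n−t}) = I_t(L_{n−t−1})^s + (x_{n−t}), where u_{n−t+1} = x_{n−t+1} ⋯ x_n and, by convention, I_t(L_m) = 0 when m < t. In particular, if n ≤ 2t then (I_t(L_{n−1})^s : u_{n−t+1}) + (x_{n−t}) = (x_{n−t}). -/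
open MvPolynomial

/-- The `t`-path ideal `I_t(L_m)` of the line graph on `x_1, …, x_m`, viewed as an ideal of
`S = K[x_1, …, x_n]`; it is generated by `u_i = x_i ⋯ x_{i+t-1}` for `1 ≤ i ≤ m - t + 1`,
and is zero when `m < t`. -/
noncomputable def pathIdealUpTo (K : Type*) [Field K] (n t m : ℕ) :
    Ideal (MvPolynomial (Fin n) K) :=
  Ideal.span ((pathGen K n t) '' {i : ℕ | i + t ≤ m})

/-- The monomial `u_{n-t+1} = x_{n-t+1} x_{n-t+2} ⋯ x_n`. -/
noncomputable def lastGen (K : Type*) [Field K] (n t : ℕ) : MvPolynomial (Fin n) K :=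
  ∏ j ∈ Finset.univ.filter (fun j : Fin n => n - t ≤ (j : ℕ)), X j

/-- The exponent vector of the squarefree monomial `∏ j ∈ A, X j`. -/
noncomputable def sqfreeExp {σ : Type*} (A : Finset σ) : σ →₀ ℕ :=
  ∑ j ∈ A, Finsupp.single j 1

theorem sqfreeExp_apply {σ : Type*} [DecidableEq σ] (A : Finset σ) (j : σ) :
    sqfreeExp A j = if j ∈ A then 1 else 0 := by
  simp [sqfreeExp, Finsupp.finsetSum_apply, Finsupp.single_apply]

theorem prod_X_eq_monomial_sqfreeExp {σ K : Type*} [CommSemiring K] (A : Finset σ) :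
    ∏ j ∈ A, (X j : MvPolynomial σ K) = monomial (sqfreeExp A) 1 := by
  rw [sqfreeExp, monomial_sum_one]
  rfl

open scoped Pointwise in
theorem span_monomial_image_pow {σ K : Type*} [CommSemiring K] (E : Set (σ →₀ ℕ)) (s : ℕ) :
    Ideal.span ((fun d => monomial d (1 : K)) '' E) ^ s =
      Ideal.span ((fun d => monomial d (1 : K)) ''
        {d | ∃ f : Fin s → σ →₀ ℕ, (∀ k, f k ∈ E) ∧ ∑ k, f k = d}) := by
  rw [Ideal.span, Submodule.span_pow]
  congr 1
  ext p
  rw [Set.mem_pow]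
  constructor
  · rintro ⟨f, rfl⟩
    choose g hgE hg using fun k => (f k).2
    refine ⟨∑ k, g k, ⟨g, hgE, rfl⟩, ?_⟩
    simp only [List.prod_ofFn, ← hg, monomial_sum_one]
  · rintro ⟨_, ⟨f, hf, rfl⟩, rfl⟩
    refine ⟨fun k => ⟨monomial (f k) 1, f k, hf k, rfl⟩, ?_⟩
    simp only [List.prod_ofFn, monomial_sum_one]

/-- The exponent vector of `pathGen K n t i`. -/
noncomputable def pathExp (n t i : ℕ) : Fin n →₀ ℕ :=
  sqfreeExp (Finset.univ.filter fun j : Fin n => i ≤ (j : ℕ) ∧ (j : ℕ) < i + t)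

theorem pathExp_apply (n t i : ℕ) (j : Fin n) :
    pathExp n t i j = if i ≤ (j : ℕ) ∧ (j : ℕ) < i + t then 1 else 0 := by
  simp [pathExp, sqfreeExp_apply]

theorem pathIdealUpTo_pow (K : Type*) [Field K] (n t m s : ℕ) :
    pathIdealUpTo K n t m ^ s = Ideal.span ((fun d => monomial d (1 : K)) ''
      {d | ∃ f : Fin s → Fin n →₀ ℕ,
        (∀ k, f k ∈ pathExp n t '' {i | i + t ≤ m}) ∧ ∑ k, f k = d}) := by
  rw [← span_monomial_image_pow, Set.image_image, pathIdealUpTo]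
  congr 3
  funext i
  exact prod_X_eq_monomial_sqfreeExp _

theorem pathIdealUpTo_mono (K : Type*) [Field K] (n t : ℕ) {m m' : ℕ} (h : m ≤ m') :
    pathIdealUpTo K n t m ≤ pathIdealUpTo K n t m' :=
  Ideal.span_mono (Set.image_mono fun _ hi => le_trans hi h)

theorem pathIdealUpTo_eq_bot (K : Type*) [Field K] (n t : ℕ) {m : ℕ} (h : m < t) :
    pathIdealUpTo K n t m = ⊥ := by
  have hempty : {i : ℕ | i + t ≤ m} = ∅ := by
    ext i
    simp only [Set.mem_ofPred_eq, Set.mem_empty_iff_false, iff_false]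
    omega
  rw [pathIdealUpTo, hempty, Set.image_empty, Ideal.span_empty]

theorem colon_add_span_X_le (K : Type*) [Field K] (n t : ℕ) (htn : t < n) (s : ℕ) :
    (pathIdealUpTo K n t (n - 1) ^ s).colon (Ideal.span {lastGen K n t}) ≤
      pathIdealUpTo K n t (n - t - 1) ^ s +
        Ideal.span {X (⟨n - t - 1, by omega⟩ : Fin n)} := by
  intro g hg
  have hgw : g * lastGen K n t ∈ pathIdealUpTo K n t (n - 1) ^ s :=
    Submodule.mem_colon.mp hg _ (Ideal.mem_span_singleton_self _)
  set p : Fin n := ⟨n - t - 1, by omega⟩ with hp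
  rw [lastGen, prod_X_eq_monomial_sqfreeExp, pathIdealUpTo_pow,
    mem_ideal_span_monomial_image] at hgw
  have hX : (X p : MvPolynomial (Fin n) K) = monomial (Finsupp.single p 1) 1 := rfl
  rw [pathIdealUpTo_pow, Submodule.add_eq_sup, ← Ideal.span_union, hX,
    ← Set.image_singleton (f := fun d => monomial d (1 : K)), ← Set.image_union,
    mem_ideal_span_monomial_image]
  intro e he
  by_cases hep : e p = 0
  · obtain ⟨_, ⟨f, hf, rfl⟩, hle⟩ := hgw (e + sqfreeExp _) (by
      rw [mem_support_iff, coeff_mul_monomial, mul_one]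
      exact mem_support_iff.mp he)
    choose i hi hif using hf
    have hsum (j : Fin n) : ∑ k, pathExp n t (i k) j ≤
        e j + if n - t ≤ (j : ℕ) then 1 else 0 := by
      simpa [← hif, sqfreeExp_apply, Finsupp.finsetSum_apply] using hle j
    have hpj : ¬ n - t ≤ (p : ℕ) := by simp only [hp]; omega
    have hi' (k : Fin s) : i k + t ≤ n - t - 1 := by
      have h0 : pathExp n t (i k) p ≤ 0 :=
        (Finset.single_le_sum (f := fun k => pathExp n t (i k) p)
          (fun _ _ => Nat.zero_le _) (Finset.mem_univ k)).trans
          (by simpa [hep, hpj] using hsum p)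
      have hk : i k + t ≤ n - 1 := hi k
      rw [pathExp_apply] at h0
      split_ifs at h0 with h <;> simp only [hp] at h <;> omega
    refine ⟨∑ k, f k, Or.inl ⟨f, fun k => ⟨i k, hi' k, hif k⟩, rfl⟩, fun j => ?_⟩
    simp only [← hif, Finsupp.finsetSum_apply]
    by_cases hj : n - t ≤ (j : ℕ)
    · rw [Finset.sum_eq_zero]
      · exact Nat.zero_le _
      · intro k _
        have := hi' k
        rw [pathExp_apply, if_neg (by omega)]
    · simpa [hj] using hsum j
  · exact ⟨_, Or.inr rfl, Finsupp.single_le_iff.mpr (Nat.one_le_iff_ne_zero.mpr hep)⟩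

/-- For `2 ≤ t < n` and `s ≥ 2`,
`(I_t(L_{n-1})^s : u_{n-t+1}) + (x_{n-t}) = I_t(L_{n-t-1})^s + (x_{n-t})`;
in particular, if `n ≤ 2t` then `(I_t(L_{n-1})^s : u_{n-t+1}) + (x_{n-t}) = (x_{n-t})`. -/
theorem colon_plus_var (K : Type*) [Field K] (n t : ℕ) (ht : 2 ≤ t) (htn : t < n)
    (s : ℕ) (hs : 2 ≤ s) :
    ((pathIdealUpTo K n t (n - 1) ^ s).colon (Ideal.span {lastGen K n t}) +
        Ideal.span {X (⟨n - t - 1, by omega⟩ : Fin n)} =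
      pathIdealUpTo K n t (n - t - 1) ^ s +
        Ideal.span {X (⟨n - t - 1, by omega⟩ : Fin n)}) ∧
    (n ≤ 2 * t →
      (pathIdealUpTo K n t (n - 1) ^ s).colon (Ideal.span {lastGen K n t}) +
          Ideal.span {X (⟨n - t - 1, by omega⟩ : Fin n)} =
        Ideal.span {X (⟨n - t - 1, by omega⟩ : Fin n)}) := by
  have hcolon :
      (pathIdealUpTo K n t (n - 1) ^ s).colon (Ideal.span {lastGen K n t}) +
          Ideal.span {X (⟨n - t - 1, by omega⟩ : Fin n)} =
        pathIdealUpTo K n t (n - t - 1) ^ s +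
          Ideal.span {X (⟨n - t - 1, by omega⟩ : Fin n)} := by
    refine le_antisymm (sup_le (colon_add_span_X_le K n t htn s) le_sup_right)
      (sup_le_sup_right (fun g hg => Submodule.mem_colon.mpr fun w _ => ?_) _)
    exact Ideal.mul_mem_right _ _
      (Ideal.pow_right_mono (pathIdealUpTo_mono K n t (by omega)) s hg)
  refine ⟨hcolon, fun h => hcolon.trans ?_⟩
  rw [pathIdealUpTo_eq_bot K n t (by omega), Ideal.bot_pow (by omega), Submodule.add_eq_sup,
    bot_sup_eq]
end
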